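/- arXiv:1806.03729 — 10 statements merged into one kernel-verified Lean document; each statement's English description precedes it below -/
import Mathlib

section
/- Let f be a polynomial with real coefficients in p variables, let P ∈ ℝ^p, and define the translated polynomial f̃ by f̃(x) := f(x + P). Let d : Fin p →₀ ℕ be an exponent multi-index such that every multi-index d' in the support of f satisfying d ≤ d' componentwise is equal to d (i.e., d is not componentwise strictly below any monomial occurring in f). Then the coefficient of d in f̃ equals the coefficient of d in f. -/
open MvPolynomial Finset

/-- The translation of a polynomial: `polyTranslate P f` evaluates as `x ↦ f (x + P)`. -/
noncomputable def polyTranslate {p : ℕ} (P : Fin p → ℝ) (f : MvPolynomial (Fin p) ℝ) :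
    MvPolynomial (Fin p) ℝ :=
  aeval (fun j => X j + C (P j)) f

/-- `q` is a monic polynomial with leading exponent `e`, all exponents being below `e`. -/
def LeadAt {p : ℕ} (q : MvPolynomial (Fin p) ℝ) (e : Fin p →₀ ℕ) : Prop :=
  (∀ d, ¬ d ≤ e → coeff d q = 0) ∧ coeff e q = 1

theorem LeadAt.one {p : ℕ} : LeadAt (1 : MvPolynomial (Fin p) ℝ) 0 := by
  refine ⟨fun d hd => ?_, by simp⟩
  rw [coeff_one, if_neg]
  rintro rfl
  exact hd le_rfl

theorem LeadAt.mul {p : ℕ} {q r : MvPolynomial (Fin p) ℝ} {e e' : Fin p →₀ ℕ}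
    (hq : LeadAt q e) (hr : LeadAt r e') : LeadAt (q * r) (e + e') := by
  classical
  constructor
  · intro d hd
    rw [coeff_mul]
    refine Finset.sum_eq_zero fun x hx => ?_
    rw [Finset.HasAntidiagonal.mem_antidiagonal] at hx
    by_cases h1 : x.1 ≤ e
    · by_cases h2 : x.2 ≤ e'
      · exact absurd (hx ▸ add_le_add h1 h2) hd
      · rw [hr.1 _ h2, mul_zero]
    · rw [hq.1 _ h1, zero_mul]
  · rw [coeff_mul, Finset.sum_eq_single (e, e')]
    · simp [hq.2, hr.2]
    · intro x hx hne
      rw [Finset.HasAntidiagonal.mem_antidiagonal] at hx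
      by_cases h1 : x.1 ≤ e
      · by_cases h2 : x.2 ≤ e'
        · refine absurd ?_ hne
          have key : ∀ j, x.1 j = e j ∧ x.2 j = e' j := by
            intro j
            have a := h1 j
            have b := h2 j
            have c := DFunLike.congr_fun hx j
            simp only [Finsupp.add_apply] at c
            omega
          exact Prod.ext (Finsupp.ext fun j => (key j).1) (Finsupp.ext fun j => (key j).2)
        · rw [hr.1 _ h2, mul_zero]
      · rw [hq.1 _ h1, zero_mul]
    · intro h
      simp at h

theorem LeadAt.X_add_C {p : ℕ} (j : Fin p) (c : ℝ) :
    LeadAt (X j + C c) (Finsupp.single j 1) := by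
  classical
  constructor
  · intro d hd
    rw [coeff_add, coeff_X, coeff_C, if_neg, if_neg, add_zero]
    · rintro rfl
      exact hd (zero_le)
    · rintro rfl
      exact hd le_rfl
  · rw [coeff_add, coeff_X, coeff_C, if_pos rfl, if_neg, add_zero]
    intro h
    have := DFunLike.congr_fun h j
    simp at this

theorem leadAt_translate {p : ℕ} (P : Fin p → ℝ) (e : Fin p →₀ ℕ) :
    LeadAt (polyTranslate P (monomial e 1)) e := by
  induction e using Finsupp.induction_linear with
  | zero => simpa [polyTranslate] using LeadAt.one
  | add e e' h h' =>
    have : (monomial (e + e') (1 : ℝ)) = monomial e 1 * monomial e' 1 := by simp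
    rw [this, polyTranslate, map_mul]
    exact h.mul h'
  | single j n =>
    have : polyTranslate P (monomial (Finsupp.single j n) 1) = (X j + C (P j)) ^ n := by
      rw [← X_pow_eq_monomial, polyTranslate, map_pow, aeval_X]
    rw [this]
    induction n with
    | zero => simpa using LeadAt.one
    | succ n ih =>
      rw [pow_succ, Finsupp.single_add]
      refine LeadAt.mul (ih ?_) (LeadAt.X_add_C _ _)
      rw [← X_pow_eq_monomial, polyTranslate, map_pow, aeval_X]

/-- **Generalization of Proposition 1 (Remark)**: if the multi-index `d` is not
componentwise strictly below any monomial occurring in `f`, then the coefficient of `d`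
is unchanged by translation of the variables. -/
theorem coeff_invariant_of_maximal
    (p : ℕ) (f : MvPolynomial (Fin p) ℝ) (P : Fin p → ℝ) (d : Fin p →₀ ℕ)
    (hmax : ∀ d' ∈ f.support, d ≤ d' → d' = d) :
    coeff d (polyTranslate P f) = coeff d f := by
  classical
  have hf : polyTranslate P f
      = ∑ e ∈ f.support, coeff e f • polyTranslate P (monomial e 1) := by
    conv_lhs => rw [f.as_sum]
    simp only [polyTranslate]
    rw [map_sum]
    refine Finset.sum_congr rfl fun e _ => ?_
    rw [← map_smul, smul_monomial, smul_eq_mul, mul_one]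
  rw [hf, coeff_sum]
  simp only [coeff_smul, smul_eq_mul]
  rw [Finset.sum_eq_single d]
  · rw [(leadAt_translate P d).2, mul_one]
  · intro e he hne
    rw [(leadAt_translate P e).1 d (fun h => hne (hmax e he h)), mul_zero]
  · intro h
    rw [notMem_support_iff.1 h, zero_mul]
end

section
/- Fix p, n, D ∈ ℕ, data y ∈ ℝ^n, a matrix M ∈ ℝ^{n×p} with rows M_i, a vector P ∈ ℝ^p, and the translated matrix M̃ with rows M̃_i := M_i − P. Define SSR_M(f) := ∑_{i=1}^n (y_i − f(M_i))² for a polynomial f in p variables, and let f̃(x) := f(x + P). If f₀ has total degree at most D and minimizes SSR_M over all polynomials of total degree at most D, then f̃₀ minimizes SSR_{M̃} over all polynomials of total degree at most D; moreover the fitted values coincide (f̃₀(M̃_i) = f₀(M_i) for all i) and the coefficients of f̃₀ and f₀ agree on every multi-index of degree sum exactly D. -/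
open MvPolynomial Finset

/-- The sum of squared residuals of the polynomial `f` fitted on data `y` with
design points the rows of `M`. -/
noncomputable def SSR {p n : ℕ} (y : Fin n → ℝ) (M : Fin n → Fin p → ℝ)
    (f : MvPolynomial (Fin p) ℝ) : ℝ :=
  ∑ i, (y i - eval (M i) f) ^ 2

theorem polyTranslate_coeff_monomial {p : ℕ} (P : Fin p → ℝ) (e : Fin p →₀ ℕ) (a : ℝ) :
    ∀ d : Fin p →₀ ℕ, (monomial e a).totalDegree ≤ d.degree →
      coeff d (polyTranslate P (monomial e a)) = coeff d (monomial e a) := by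
  refine induction_on_monomial
    (motive := fun f => ∀ d : Fin p →₀ ℕ, f.totalDegree ≤ d.degree →
      coeff d (polyTranslate P f) = coeff d f) ?_ ?_ e a
  · intro a d _
    simp [polyTranslate, algebraMap_eq]
  · intro f j ih d hd
    by_cases hf : f = 0
    · subst hf
      simp [polyTranslate]
    rw [totalDegree_mul_of_isDomain hf (X_ne_zero j), totalDegree_X] at hd
    have h1 : polyTranslate P (f * X j) =
        polyTranslate P f * X j + C (P j) * polyTranslate P f := by
      simp [polyTranslate, mul_add, mul_comm (C (P j))]
    have h2 : coeff d (polyTranslate P f) = 0 := by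
      rw [ih d (by omega)]
      apply coeff_eq_zero_of_totalDegree_lt
      rw [Finsupp.degree_apply] at hd
      omega
    rw [h1, coeff_add, coeff_C_mul, h2, mul_zero, add_zero, coeff_mul_X', coeff_mul_X']
    split_ifs with hj
    · apply ih
      have h3 : d - Finsupp.single j 1 + Finsupp.single j 1 = d := by
        apply tsub_add_cancel_of_le
        rw [Finsupp.single_le_iff]
        exact Nat.one_le_iff_ne_zero.mpr (Finsupp.mem_support_iff.mp hj)
      have h4 := congrArg Finsupp.degree h3
      rw [map_add, Finsupp.degree_single] at h4
      omega
    · rfl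

theorem polyTranslate_coeff {p : ℕ} (P : Fin p → ℝ) (f : MvPolynomial (Fin p) ℝ)
    (d : Fin p →₀ ℕ) (hd : f.totalDegree ≤ d.degree) :
    coeff d (polyTranslate P f) = coeff d f := by
  have h : polyTranslate P f = ∑ e ∈ f.support, polyTranslate P (monomial e (coeff e f)) := by
    conv_lhs => rw [f.as_sum]
    simp only [polyTranslate, map_sum]
  rw [h]
  conv_rhs => rw [f.as_sum]
  rw [coeff_sum, coeff_sum]
  refine Finset.sum_congr rfl fun e he => polyTranslate_coeff_monomial P e _ d ?_
  refine (totalDegree_monomial_le _ _).trans (le_trans ?_ hd)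
  exact le_totalDegree he

theorem polyTranslate_totalDegree_le {p : ℕ} (P : Fin p → ℝ) (f : MvPolynomial (Fin p) ℝ) :
    (polyTranslate P f).totalDegree ≤ f.totalDegree := by
  rw [totalDegree_eq, Finset.sup_le_iff]
  intro d hd
  by_contra! hlt
  rw [mem_support_iff] at hd
  have hdd : f.totalDegree < d.degree := by
    simpa [Finsupp.card_toMultiset, Finsupp.degree_apply, Finsupp.sum] using hlt
  rw [polyTranslate_coeff P f d hdd.le] at hd
  exact hd (coeff_eq_zero_of_totalDegree_lt (by simpa [Finsupp.degree_apply] using hdd))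

theorem eval_polyTranslate {p : ℕ} (P x : Fin p → ℝ) (f : MvPolynomial (Fin p) ℝ) :
    eval x (polyTranslate P f) = eval (fun j => x j + P j) f := by
  unfold polyTranslate
  induction f using MvPolynomial.induction_on with
  | C a => simp [algebraMap_eq]
  | add f g hf hg => simp only [map_add, hf, hg]
  | mul_X f j hf => simp only [map_mul, hf]; simp

/-- **Corollary 1 (OLS)**: if `f₀` minimizes the SSR over the complete polynomial model
of total degree at most `D` for the coding `M`, then the translated polynomial `f̃₀`
minimizes the SSR over the same model for the translated coding `M̃`; moreover the fitted
values coincide and the coefficients of monomials of highest total degree `D` agree. -/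
theorem ols_invariant_under_translation
    (p n D : ℕ) (y : Fin n → ℝ) (M : Fin n → Fin p → ℝ) (P : Fin p → ℝ)
    (f₀ : MvPolynomial (Fin p) ℝ) (hf₀ : f₀.totalDegree ≤ D)
    (hmin : ∀ f : MvPolynomial (Fin p) ℝ, f.totalDegree ≤ D →
      SSR y M f₀ ≤ SSR y M f) :
    ((polyTranslate P f₀).totalDegree ≤ D ∧
      ∀ f : MvPolynomial (Fin p) ℝ, f.totalDegree ≤ D →
        SSR y (fun i j => M i j - P j) (polyTranslate P f₀) ≤
          SSR y (fun i j => M i j - P j) f) ∧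
    (∀ i, eval (fun j => M i j - P j) (polyTranslate P f₀) = eval (M i) f₀) ∧
    (∀ d : Fin p →₀ ℕ, ∑ j, d j = D →
      coeff d (polyTranslate P f₀) = coeff d f₀) := by
  have hev : ∀ i, eval (fun j => M i j - P j) (polyTranslate P f₀) = eval (M i) f₀ := by
    intro i
    simp [eval_polyTranslate]
  refine ⟨⟨(polyTranslate_totalDegree_le P f₀).trans hf₀, fun f hf => ?_⟩, hev, fun d hd => ?_⟩
  · have h := hmin (polyTranslate (fun j => - P j) f)
      ((polyTranslate_totalDegree_le _ f).trans hf)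
    simp only [SSR, eval_polyTranslate, ← sub_eq_add_neg] at h
    simpa only [SSR, hev] using h
  · apply polyTranslate_coeff
    rw [Finsupp.degree_eq_sum, hd]
    exact hf₀
end

section
/- Fix p, n, D ∈ ℕ, data y ∈ ℝ^n, a matrix M ∈ ℝ^{n×p} with rows M_i, a vector P ∈ ℝ^p, and the translated matrix M̃ with rows M̃_i := M_i − P. The infimum of SSR_M(f) := ∑_{i=1}^n (y_i − f(M_i))² over all polynomials f in p variables of total degree at most D equals the infimum of SSR_{M̃}(f) over all polynomials f of total degree at most D. -/
open MvPolynomial Finset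

lemma shift_totalDegree {p : ℕ} (Q : Fin p → ℝ) (f : MvPolynomial (Fin p) ℝ) :
    (bind₁ (fun j => X j + C (Q j)) f).totalDegree ≤ f.totalDegree := by
  rw [bind₁, aeval_def, eval₂_eq]
  refine totalDegree_finsetSum_le fun d hd => ?_
  refine (totalDegree_mul _ _).trans ?_
  have h1 : (algebraMap ℝ (MvPolynomial (Fin p) ℝ) (coeff d f)).totalDegree = 0 :=
    totalDegree_C _
  rw [h1, zero_add]
  refine (totalDegree_finsetProd _ _).trans ?_
  refine le_trans ?_ (le_totalDegree hd)
  rw [Finsupp.sum]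
  refine Finset.sum_le_sum fun i _ => ?_
  refine (totalDegree_pow _ _).trans ?_
  have h2 : (X i + C (Q i) : MvPolynomial (Fin p) ℝ).totalDegree ≤ 1 := by
    refine (totalDegree_add _ _).trans ?_
    simp
  simpa using Nat.mul_le_mul_left (d i) h2

lemma shift_SSR {p n : ℕ} (y : Fin n → ℝ) (M : Fin n → Fin p → ℝ) (Q : Fin p → ℝ)
    (f : MvPolynomial (Fin p) ℝ) :
    SSR y M (bind₁ (fun j => X j + C (Q j)) f) = SSR y (fun i j => M i j + Q j) f := by
  unfold SSR
  refine Finset.sum_congr rfl fun i _ => ?_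
  have h : eval (M i) (bind₁ (fun j => X j + C (Q j)) f) =
      eval (fun j => M i j + Q j) f := by
    rw [eval, eval₂Hom_bind₁]
    simp
  rw [h]

/-- The optimal (infimal) SSR over the complete polynomial model of total degree at most
`D` is the same for the original coding `M` and the translated coding `M̃ = M - 1ₙPᵗ`. -/
theorem inf_ssr_invariant_under_translation
    (p n D : ℕ) (y : Fin n → ℝ) (M : Fin n → Fin p → ℝ) (P : Fin p → ℝ) :
    sInf (SSR y M '' {f : MvPolynomial (Fin p) ℝ | f.totalDegree ≤ D}) =
      sInf (SSR y (fun i j => M i j - P j) ''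
        {f : MvPolynomial (Fin p) ℝ | f.totalDegree ≤ D}) := by
  congr 1
  ext r
  constructor
  · rintro ⟨f, hf, rfl⟩
    refine ⟨_, (shift_totalDegree P f).trans hf, ?_⟩
    rw [shift_SSR]
    simp
  · rintro ⟨f, hf, rfl⟩
    refine ⟨_, (shift_totalDegree (fun j => - P j) f).trans hf, ?_⟩
    rw [shift_SSR]
    simp [sub_eq_add_neg]
end

section
/- Fix p, n, D ∈ ℕ, data y ∈ ℝ^n, a matrix M ∈ ℝ^{n×p} with rows M_i, a vector P ∈ ℝ^p, and the translated matrix M̃ with rows M̃_i := M_i − P. Let Φ : ((Fin p →₀ ℕ) → ℝ) → ℝ be any penalty function that depends only on the coefficients of total degree exactly D, i.e., Φ(c) = Φ(c') whenever c(d) = c'(d) for every multi-index d with degree sum D. Define the objective J_M(f) := ∑_{i=1}^n (y_i − f(M_i))² + Φ(coeff f), and let f̃(x) := f(x + P). Then: (i) J_{M̃}(f̃) = J_M(f) for every polynomial f of total degree at most D; (ii) if f₀ of total degree at most D minimizes J_M over all polynomials of total degree at most D, then f̃₀ minimizes J_{M̃} over the same set, the fitted values coincide (f̃₀(M̃_i)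 = f₀(M_i) for all i), and the coefficients of f̃₀ and f₀ agree on every multi-index of degree sum exactly D. -/
open MvPolynomial Finset

/-- Penalized least-squares objective: sum of squared residuals plus a penalty `Φ`
applied to the coefficient function of the polynomial. -/
noncomputable def penObj {p n : ℕ} (y : Fin n → ℝ) (M : Fin n → Fin p → ℝ)
    (Φ : ((Fin p →₀ ℕ) → ℝ) → ℝ) (f : MvPolynomial (Fin p) ℝ) : ℝ :=
  ∑ i, (y i - eval (M i) f) ^ 2 + Φ (fun d => coeff d f)

/-- Polynomials all of whose monomials have degree sum `< k`. -/
def LowDeg {p : ℕ} (k : ℕ) (f : MvPolynomial (Fin p) ℝ) : Prop :=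
  ∀ d : Fin p →₀ ℕ, k ≤ ∑ j, d j → coeff d f = 0

lemma LowDeg.add {p k : ℕ} {f g : MvPolynomial (Fin p) ℝ} (hf : LowDeg k f) (hg : LowDeg k g) :
    LowDeg k (f + g) := by
  intro d hd
  rw [coeff_add, hf d hd, hg d hd, add_zero]

lemma LowDeg.mono {p k l : ℕ} {f : MvPolynomial (Fin p) ℝ} (hf : LowDeg k f) (h : k ≤ l) :
    LowDeg l f := fun d hd => hf d (h.trans hd)

lemma LowDeg.mul_X {p k : ℕ} {f : MvPolynomial (Fin p) ℝ} (hf : LowDeg k f) (i : Fin p) :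
    LowDeg (k + 1) (f * X i) := by
  intro d hd
  rw [coeff_mul_X']
  split_ifs with h
  · apply hf
    have h1 : 1 ≤ d i := Nat.one_le_iff_ne_zero.mpr (Finsupp.mem_support_iff.mp h)
    have h2 : d = (d - Finsupp.single i 1) + Finsupp.single i 1 := by
      ext j
      by_cases hj : i = j
      · subst hj; simp; omega
      · simp [Finsupp.single_apply, hj]
    rw [h2] at hd
    simp only [Finsupp.add_apply, Finset.sum_add_distrib] at hd
    have h3 : ∑ j, (Finsupp.single i 1 : Fin p →₀ ℕ) j = 1 := by
      simp [Finsupp.single_apply]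
    omega
  · rfl

lemma LowDeg.mul_C {p k : ℕ} {f : MvPolynomial (Fin p) ℝ} (hf : LowDeg k f) (a : ℝ) :
    LowDeg k (f * C a) := by
  intro d hd
  rw [mul_comm, coeff_C_mul, hf d hd, mul_zero]

lemma lowDeg_monomial {p : ℕ} (s : Fin p →₀ ℕ) (a : ℝ) :
    LowDeg (∑ j, s j + 1) (monomial s a) := by
  intro d hd
  rw [coeff_monomial, if_neg]
  rintro rfl
  omega

lemma lowDeg_iff {p D : ℕ} (f : MvPolynomial (Fin p) ℝ) :
    LowDeg (D + 1) f ↔ f.totalDegree ≤ D := by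
  have key : ∀ d : Fin p →₀ ℕ, (d.sum fun _ e => e) = ∑ j, d j := fun d =>
    Finsupp.sum_fintype _ _ (fun _ => rfl)
  constructor
  · intro h
    refine Finset.sup_le fun d hd => ?_
    by_contra hlt
    rw [key] at hlt
    exact (mem_support_iff.mp hd) (h d (by omega))
  · intro h d hd
    by_contra hne
    have := le_totalDegree (mem_support_iff.mpr hne)
    rw [key] at this
    omega

lemma polyTranslate_add {p : ℕ} (P : Fin p → ℝ) (f g : MvPolynomial (Fin p) ℝ) :
    polyTranslate P (f + g) = polyTranslate P f + polyTranslate P g := by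
  simp [polyTranslate]

lemma translate_monomial {p : ℕ} (P : Fin p → ℝ) (s : Fin p →₀ ℕ) (a : ℝ) :
    LowDeg (∑ j, s j) (polyTranslate P (monomial s a) - monomial s a) := by
  induction hk : ∑ j, s j generalizing s with
  | zero =>
    have : s = 0 := by
      ext j
      simpa using (Finset.sum_eq_zero_iff.mp hk) j (Finset.mem_univ j)
    subst this
    intro d _
    have : (monomial (0 : Fin p →₀ ℕ)) a = C a := rfl
    simp [polyTranslate, this, algebraMap_eq]
  | succ k ih =>
    obtain ⟨i, hi⟩ : ∃ i, s i ≠ 0 := by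
      by_contra! h
      simp [h] at hk
    obtain ⟨t, rfl⟩ : ∃ t : Fin p →₀ ℕ, s = t + Finsupp.single i 1 := by
      refine ⟨s - Finsupp.single i 1, ?_⟩
      ext j
      by_cases hj : i = j
      · subst hj; simp; omega
      · simp [Finsupp.single_apply, hj]
    have h3 : ∑ j, (Finsupp.single i 1 : Fin p →₀ ℕ) j = 1 := by
      simp [Finsupp.single_apply]
    have ht : ∑ j, t j = k := by
      simp only [Finsupp.add_apply, Finset.sum_add_distrib] at hk
      omega
    have h := ih t ht
    have hm : monomial (t + Finsupp.single i 1) a = monomial t a * X i := by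
      simp [X, monomial_mul]
    have hT : polyTranslate P (monomial t a * X i)
        = polyTranslate P (monomial t a) * (X i + C (P i)) := by
      simp only [polyTranslate, map_mul, aeval_X]
    have e : polyTranslate P (monomial t a * X i) - monomial t a * X i
        = (polyTranslate P (monomial t a) - monomial t a) * X i
          + ((polyTranslate P (monomial t a) - monomial t a) + monomial t a) * C (P i) := by
      rw [hT]; ring
    rw [hm, e]
    have hmon := lowDeg_monomial t a
    rw [ht] at hmon
    exact (h.mul_X i).add (((h.mono (Nat.le_succ k)).add hmon).mul_C _)

lemma translate_sub {p D : ℕ} (P : Fin p → ℝ) (f : MvPolynomial (Fin p) ℝ)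
    (hf : f.totalDegree ≤ D) : LowDeg D (polyTranslate P f - f) := by
  have e : polyTranslate P f - f
      = ∑ s ∈ f.support, (polyTranslate P (monomial s (coeff s f)) - monomial s (coeff s f)) := by
    rw [Finset.sum_sub_distrib, ← f.as_sum]
    congr 1
    conv_lhs => rw [f.as_sum]
    simp only [polyTranslate, map_sum]
  rw [e]
  intro d hd
  rw [coeff_sum]
  refine Finset.sum_eq_zero fun s hs => translate_monomial P s _ d (le_trans ?_ hd)
  have := le_totalDegree hs
  rw [Finsupp.sum_fintype _ _ (fun _ => rfl)] at this
  exact this.trans hf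

lemma translate_coeff {p D : ℕ} (P : Fin p → ℝ) (f : MvPolynomial (Fin p) ℝ)
    (hf : f.totalDegree ≤ D) (d : Fin p →₀ ℕ) (hd : ∑ j, d j = D) :
    coeff d (polyTranslate P f) = coeff d f := by
  have := translate_sub P f hf d hd.ge
  rw [coeff_sub] at this
  linarith

lemma translate_degree {p D : ℕ} (P : Fin p → ℝ) (f : MvPolynomial (Fin p) ℝ)
    (hf : f.totalDegree ≤ D) : (polyTranslate P f).totalDegree ≤ D := by
  rw [← lowDeg_iff]
  have := ((translate_sub P f hf).mono (Nat.le_succ D)).add ((lowDeg_iff f).mpr hf)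
  simpa using this

lemma translate_eval {p : ℕ} (P m : Fin p → ℝ) (f : MvPolynomial (Fin p) ℝ) :
    eval (fun j => m j - P j) (polyTranslate P f) = eval m f := by
  induction f using MvPolynomial.induction_on with
  | C a => simp [polyTranslate, algebraMap_eq]
  | add f g hf hg => rw [polyTranslate_add, map_add, map_add, hf, hg]
  | mul_X f i hf =>
    have : polyTranslate P (f * X i) = polyTranslate P f * (X i + C (P i)) := by
      simp only [polyTranslate, map_mul, aeval_X]
    rw [this, map_mul, map_mul, hf]
    simp

lemma translate_neg {p : ℕ} (P : Fin p → ℝ) (f : MvPolynomial (Fin p) ℝ) :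
    polyTranslate P (polyTranslate (fun j => - P j) f) = f := by
  induction f using MvPolynomial.induction_on with
  | C a => simp [polyTranslate, algebraMap_eq]
  | add f g hf hg => rw [polyTranslate_add, polyTranslate_add, hf, hg]
  | mul_X f i hf =>
    simp only [polyTranslate] at hf
    simp only [polyTranslate, map_mul, hf]
    simp [algebraMap_eq]

/-- **Corollary 2**: a penalized regression on the complete polynomial model of total
degree at most `D` whose penalty `Φ` depends only on the coefficients of monomials of
total degree exactly `D` is invariant under translations of the coding: the objective
values of `f` and its translate `f̃` coincide, minimizers correspond to minimizers,
fitted values coincide, and the coefficients of highest total degree agree. -/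
theorem penalized_regression_invariant_under_translation
    (p n D : ℕ) (y : Fin n → ℝ) (M : Fin n → Fin p → ℝ) (P : Fin p → ℝ)
    (Φ : ((Fin p →₀ ℕ) → ℝ) → ℝ)
    (hΦ : ∀ c c' : (Fin p →₀ ℕ) → ℝ,
      (∀ d : Fin p →₀ ℕ, ∑ j, d j = D → c d = c' d) → Φ c = Φ c') :
    (∀ f : MvPolynomial (Fin p) ℝ, f.totalDegree ≤ D →
      penObj y (fun i j => M i j - P j) Φ (polyTranslate P f) = penObj y M Φ f) ∧
    (∀ f₀ : MvPolynomial (Fin p) ℝ, f₀.totalDegree ≤ D →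
      (∀ f : MvPolynomial (Fin p) ℝ, f.totalDegree ≤ D →
        penObj y M Φ f₀ ≤ penObj y M Φ f) →
      ((polyTranslate P f₀).totalDegree ≤ D ∧
        ∀ f : MvPolynomial (Fin p) ℝ, f.totalDegree ≤ D →
          penObj y (fun i j => M i j - P j) Φ (polyTranslate P f₀) ≤
            penObj y (fun i j => M i j - P j) Φ f) ∧
      (∀ i, eval (fun j => M i j - P j) (polyTranslate P f₀) = eval (M i) f₀) ∧
      (∀ d : Fin p →₀ ℕ, ∑ j, d j = D →
        coeff d (polyTranslate P f₀) = coeff d f₀)) := by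
  have key : ∀ f : MvPolynomial (Fin p) ℝ, f.totalDegree ≤ D →
      penObj y (fun i j => M i j - P j) Φ (polyTranslate P f) = penObj y M Φ f := by
    intro f hf
    unfold penObj
    rw [hΦ _ _ (translate_coeff P f hf)]
    simp only [translate_eval]
  refine ⟨key, fun f₀ h₀ hmin => ⟨⟨translate_degree P f₀ h₀, fun f hf => ?_⟩,
    fun i => translate_eval P (M i) f₀, translate_coeff P f₀ h₀⟩⟩
  have hg := translate_degree (fun j => - P j) f hf
  have h2 := key _ hg
  rw [translate_neg] at h2
  rw [key f₀ h₀, h2]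
  exact hmin _ hg
end

section
/- Fix p, n ∈ ℕ, data y ∈ ℝ^n, a matrix M ∈ ℝ^{n×p} with rows M_i, a vector P ∈ ℝ^p, the translated matrix M̃ with rows M̃_i := M_i − P, and λ ≥ 0. Define the RRBLUP objective R_M(μ, β) := ∑_{i=1}^n (y_i − μ − ⟨M_i, β⟩)² + λ ∑_{j=1}^p β_j². Then R_{M̃}(μ + ⟨P, β⟩, β) = R_M(μ, β) for all μ ∈ ℝ, β ∈ ℝ^p; consequently (μ̂, β̂) minimizes R_M over ℝ × ℝ^p if and only if (μ̂ + ⟨P, β̂⟩, β̂) minimizes R_{M̃}, and the corresponding fitted values μ̂ + ⟨M_i, β̂⟩ and (μ̂ + ⟨P, β̂⟩) + ⟨M̃_i, β̂⟩ are equal for all i. -/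
open Finset

/-- The RRBLUP objective: residual sum of squares with unpenalized intercept `μ` and
ℓ2-penalized additive effects `β` (Eq. (5) of the paper). -/
noncomputable def rrblupObj {p n : ℕ} (y : Fin n → ℝ) (M : Fin n → Fin p → ℝ)
    (lam : ℝ) (μ : ℝ) (β : Fin p → ℝ) : ℝ :=
  ∑ i, (y i - μ - ∑ j, M i j * β j) ^ 2 + lam * ∑ j, β j ^ 2

/-- **Corollary 3**: RRBLUP (intercept unpenalized, additive effects ℓ2-penalized) is
invariant under translations of the marker coding: the objective values correspond under
`(μ, β) ↦ (μ + ⟨P, β⟩, β)`, minimizers correspond to minimizers, and fitted values are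
unchanged. -/
theorem rrblup_invariant_under_translation
    (p n : ℕ) (y : Fin n → ℝ) (M : Fin n → Fin p → ℝ) (P : Fin p → ℝ)
    (lam : ℝ) (hlam : 0 ≤ lam) :
    (∀ (μ : ℝ) (β : Fin p → ℝ),
      rrblupObj y (fun i j => M i j - P j) lam (μ + ∑ j, P j * β j) β =
        rrblupObj y M lam μ β) ∧
    (∀ (μh : ℝ) (βh : Fin p → ℝ),
      (∀ (μ : ℝ) (β : Fin p → ℝ), rrblupObj y M lam μh βh ≤ rrblupObj y M lam μ β) ↔
      (∀ (μ : ℝ) (β : Fin p → ℝ),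
        rrblupObj y (fun i j => M i j - P j) lam (μh + ∑ j, P j * βh j) βh ≤
          rrblupObj y (fun i j => M i j - P j) lam μ β)) ∧
    (∀ (μh : ℝ) (βh : Fin p → ℝ) (i : Fin n),
      μh + ∑ j, M i j * βh j =
        (μh + ∑ j, P j * βh j) + ∑ j, (M i j - P j) * βh j) := by
  have fit : ∀ (μ : ℝ) (β : Fin p → ℝ) (i : Fin n),
      μ + ∑ j, M i j * β j = (μ + ∑ j, P j * β j) + ∑ j, (M i j - P j) * β j := by
    intro μ β i
    simp only [sub_mul, Finset.sum_sub_distrib]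
    ring
  have obj : ∀ (μ : ℝ) (β : Fin p → ℝ),
      rrblupObj y (fun i j => M i j - P j) lam (μ + ∑ j, P j * β j) β =
        rrblupObj y M lam μ β := by
    intro μ β
    unfold rrblupObj
    congr 1
    refine Finset.sum_congr rfl fun i _ => ?_
    rw [sub_sub, sub_sub, fit μ β i]
  refine ⟨obj, fun μh βh => ⟨fun h μ β => ?_, fun h μ β => ?_⟩, fit⟩
  · have h1 := h (μ - ∑ j, P j * β j) β
    rw [← obj μh βh, ← obj (μ - ∑ j, P j * β j) β, sub_add_cancel] at h1
    exact h1
  · rw [← obj μh βh, ← obj μ β]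
    exact h _ _
end

section
/- Fix p, n ∈ ℕ, data y ∈ ℝ^n, a matrix M ∈ ℝ^{n×p} with rows M_i, a vector P ∈ ℝ^p, the translated matrix M̃ with rows M̃_i := M_i − P, and λ ≥ 0. Define the LASSO objective L_M(μ, β) := ∑_{i=1}^n (y_i − μ − ⟨M_i, β⟩)² + λ ∑_{j=1}^p |β_j|. Then L_{M̃}(μ + ⟨P, β⟩, β) = L_M(μ, β) for all μ ∈ ℝ, β ∈ ℝ^p; consequently (μ̂, β̂) minimizes L_M over ℝ × ℝ^p if and only if (μ̂ + ⟨P, β̂⟩, β̂) minimizes L_{M̃}, and the corresponding fitted values are equal for all i. -/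
open Finset

/-- The additive LASSO objective: residual sum of squares with unpenalized intercept `μ`
and ℓ1-penalized additive effects `β`. -/
noncomputable def lassoObj {p n : ℕ} (y : Fin n → ℝ) (M : Fin n → Fin p → ℝ)
    (lam : ℝ) (μ : ℝ) (β : Fin p → ℝ) : ℝ :=
  ∑ i, (y i - μ - ∑ j, M i j * β j) ^ 2 + lam * ∑ j, |β j|

/-- **Corollary 4**: additive LASSO regression (intercept unpenalized, additive effects
ℓ1-penalized) is invariant under translations of the marker coding: the objective values
correspond under `(μ, β) ↦ (μ + ⟨P, β⟩, β)`, minimizers correspond to minimizers, and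
fitted values are unchanged. -/
theorem lasso_invariant_under_translation
    (p n : ℕ) (y : Fin n → ℝ) (M : Fin n → Fin p → ℝ) (P : Fin p → ℝ)
    (lam : ℝ) (hlam : 0 ≤ lam) :
    (∀ (μ : ℝ) (β : Fin p → ℝ),
      lassoObj y (fun i j => M i j - P j) lam (μ + ∑ j, P j * β j) β =
        lassoObj y M lam μ β) ∧
    (∀ (μh : ℝ) (βh : Fin p → ℝ),
      (∀ (μ : ℝ) (β : Fin p → ℝ), lassoObj y M lam μh βh ≤ lassoObj y M lam μ β) ↔
      (∀ (μ : ℝ) (β : Fin p → ℝ),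
        lassoObj y (fun i j => M i j - P j) lam (μh + ∑ j, P j * βh j) βh ≤
          lassoObj y (fun i j => M i j - P j) lam μ β)) ∧
    (∀ (μh : ℝ) (βh : Fin p → ℝ) (i : Fin n),
      μh + ∑ j, M i j * βh j =
        (μh + ∑ j, P j * βh j) + ∑ j, (M i j - P j) * βh j) := by
  have fit : ∀ (μ : ℝ) (β : Fin p → ℝ) (i : Fin n),
      μ + ∑ j, M i j * β j =
        (μ + ∑ j, P j * β j) + ∑ j, (M i j - P j) * β j := by
    intro μ β i
    simp only [sub_mul, Finset.sum_sub_distrib]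
    ring
  have obj : ∀ (μ : ℝ) (β : Fin p → ℝ),
      lassoObj y (fun i j => M i j - P j) lam (μ + ∑ j, P j * β j) β =
        lassoObj y M lam μ β := by
    intro μ β
    unfold lassoObj
    congr 1
    refine Finset.sum_congr rfl fun i _ => ?_
    rw [sub_sub, sub_sub, ← fit μ β i]
  refine ⟨obj, fun μh βh => ⟨fun h μ β => ?_, fun h μ β => ?_⟩, fit⟩
  · rw [obj]
    have h1 := obj (μ - ∑ j, P j * β j) β
    rw [sub_add_cancel] at h1
    rw [h1]
    exact h _ _
  · rw [← obj μh βh, ← obj μ β]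
    exact h _ _
end

section
/- Fix p, n ∈ ℕ, data y ∈ ℝ^n, a matrix M ∈ ℝ^{n×p} with rows M_i, a vector P ∈ ℝ^p, the translated matrix M̃ with rows M̃_i := M_i − P, and λ ≥ 0. For μ ∈ ℝ, β ∈ ℝ^p and h = (h_{j,k})_{1≤k<j≤p}, define the prediction function g_{μ,β,h}(x) := μ + ⟨x, β⟩ + ∑_{k<j} h_{j,k} x_j x_k and the objective Q_M(μ, β, h) := ∑_{i=1}^n (y_i − g_{μ,β,h}(M_i))² + λ ∑_{k<j} h_{j,k}², which penalizes only the interaction coefficients. Then for every (μ, β, h) there exist μ' ∈ ℝ and β' ∈ ℝ^p such that g_{μ',β',h}(M̃_i) = g_{μ,β,h}(M_i) for all i and Q_{M̃}(μ', β', h) = Q_M(μ, β, h); consequently, if (μ̂, β̂, ĥ) minimizes Q_M, then there is a minimizer of Q_{M̃} with the same interaction coefficients ĥ and the same fitted values, and conversely. -/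
open Finset

/-- Prediction function of the first order epistasis model (Eq. (7) of the paper):
`g μ β h x = μ + ⟨x, β⟩ + ∑_{k<j} h j k * x j * x k`. -/
noncomputable def epiPred {p : ℕ} (μ : ℝ) (β : Fin p → ℝ) (h : Fin p → Fin p → ℝ)
    (x : Fin p → ℝ) : ℝ :=
  μ + ∑ j, x j * β j + ∑ j, ∑ k ∈ Finset.Iio j, h j k * x j * x k

/-- eRRBLUP-2 objective: residual sum of squares of the epistasis model with a penalty
only on the interaction coefficients `h`. -/
noncomputable def epiObj {p n : ℕ} (y : Fin n → ℝ) (M : Fin n → Fin p → ℝ)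
    (lam : ℝ) (μ : ℝ) (β : Fin p → ℝ) (h : Fin p → Fin p → ℝ) : ℝ :=
  ∑ i, (y i - epiPred μ β h (M i)) ^ 2 + lam * ∑ j, ∑ k ∈ Finset.Iio j, h j k ^ 2

/-- Translating the coding is absorbed by the intercept and the main effects. -/
lemma epiPred_translate {p : ℕ} (P : Fin p → ℝ) (μ : ℝ) (β : Fin p → ℝ)
    (h : Fin p → Fin p → ℝ) :
    ∃ (μ' : ℝ) (β' : Fin p → ℝ), ∀ z : Fin p → ℝ,
      epiPred μ' β' h z = epiPred μ β h (fun j => z j + P j) := by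
  refine ⟨μ + ∑ j, P j * β j + ∑ j, ∑ k ∈ Finset.Iio j, h j k * P j * P k,
    fun j => β j + ∑ k ∈ Finset.Iio j, h j k * P k + ∑ k ∈ Finset.Ioi j, h k j * P k, ?_⟩
  intro z
  have key : ∑ j, ∑ k ∈ Finset.Iio j, h j k * P j * z k
      = ∑ k, z k * ∑ j ∈ Finset.Ioi k, h j k * P j := by
    simp_rw [Finset.mul_sum]
    rw [Finset.sum_comm' (t' := Finset.univ) (s' := fun k => Finset.Ioi k) (by simp)]
    exact Finset.sum_congr rfl fun k _ => Finset.sum_congr rfl fun j _ => by ring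
  have key2 : ∑ j, ∑ k ∈ Finset.Iio j, h j k * z j * P k
      = ∑ j, z j * ∑ k ∈ Finset.Iio j, h j k * P k := by
    simp_rw [Finset.mul_sum]
    exact Finset.sum_congr rfl fun k _ => Finset.sum_congr rfl fun j _ => by ring
  have key3 : ∑ j, ∑ k ∈ Finset.Iio j, h j k * (z j + P j) * (z k + P k)
      = ∑ j, ∑ k ∈ Finset.Iio j, h j k * z j * z k
        + ∑ j, ∑ k ∈ Finset.Iio j, h j k * z j * P k
        + ∑ j, ∑ k ∈ Finset.Iio j, h j k * P j * z k
        + ∑ j, ∑ k ∈ Finset.Iio j, h j k * P j * P k := by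
    simp_rw [← Finset.sum_add_distrib]
    exact Finset.sum_congr rfl fun k _ => Finset.sum_congr rfl fun j _ => by ring
  unfold epiPred
  rw [key3, key, key2]
  simp only [mul_add, add_mul, Finset.sum_add_distrib]
  ring

/-- Equal fitted values give equal objectives. -/
lemma epiObj_congr {p n : ℕ} (y : Fin n → ℝ) (M N : Fin n → Fin p → ℝ) (lam μ μ' : ℝ)
    (β β' : Fin p → ℝ) (h : Fin p → Fin p → ℝ)
    (H : ∀ i, epiPred μ' β' h (N i) = epiPred μ β h (M i)) :
    epiObj y N lam μ' β' h = epiObj y M lam μ β h := by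
  simp only [epiObj, H]

/-- **Corollary 2 instantiated (eRRBLUP-2)**: when only the interaction coefficients are
penalized, for any `(μ, β, h)` there are `(μ', β')` reproducing the same fitted values
and the same objective value under the translated coding; consequently minimizers for
the two codings correspond, with identical interaction coefficients and fitted values. -/
theorem errblup2_invariant_under_translation
    (p n : ℕ) (y : Fin n → ℝ) (M : Fin n → Fin p → ℝ) (P : Fin p → ℝ)
    (lam : ℝ) (hlam : 0 ≤ lam) :
    (∀ (μ : ℝ) (β : Fin p → ℝ) (h : Fin p → Fin p → ℝ),
      ∃ (μ' : ℝ) (β' : Fin p → ℝ),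
        (∀ i, epiPred μ' β' h (fun j => M i j - P j) = epiPred μ β h (M i)) ∧
        epiObj y (fun i j => M i j - P j) lam μ' β' h = epiObj y M lam μ β h) ∧
    (∀ (μh : ℝ) (βh : Fin p → ℝ) (hh : Fin p → Fin p → ℝ),
      (∀ (μ : ℝ) (β : Fin p → ℝ) (h : Fin p → Fin p → ℝ),
        epiObj y M lam μh βh hh ≤ epiObj y M lam μ β h) →
      ∃ (μ' : ℝ) (β' : Fin p → ℝ),
        (∀ (μ : ℝ) (β : Fin p → ℝ) (h : Fin p → Fin p → ℝ),
          epiObj y (fun i j => M i j - P j) lam μ' β' hh ≤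
            epiObj y (fun i j => M i j - P j) lam μ β h) ∧
        (∀ i, epiPred μ' β' hh (fun j => M i j - P j) = epiPred μh βh hh (M i))) ∧
    (∀ (μt : ℝ) (βt : Fin p → ℝ) (ht : Fin p → Fin p → ℝ),
      (∀ (μ : ℝ) (β : Fin p → ℝ) (h : Fin p → Fin p → ℝ),
        epiObj y (fun i j => M i j - P j) lam μt βt ht ≤
          epiObj y (fun i j => M i j - P j) lam μ β h) →
      ∃ (μ' : ℝ) (β' : Fin p → ℝ),
        (∀ (μ : ℝ) (β : Fin p → ℝ) (h : Fin p → Fin p → ℝ),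
          epiObj y M lam μ' β' ht ≤ epiObj y M lam μ β h) ∧
        (∀ i, epiPred μ' β' ht (M i) = epiPred μt βt ht (fun j => M i j - P j))) := by
  have fwd : ∀ (μ : ℝ) (β : Fin p → ℝ) (h : Fin p → Fin p → ℝ),
      ∃ (μ' : ℝ) (β' : Fin p → ℝ),
        (∀ i, epiPred μ' β' h (fun j => M i j - P j) = epiPred μ β h (M i)) := by
    intro μ β h
    obtain ⟨μ', β', H⟩ := epiPred_translate P μ β h
    exact ⟨μ', β', fun i => by simp [H]⟩
  have bwd : ∀ (μ : ℝ) (β : Fin p → ℝ) (h : Fin p → Fin p → ℝ),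
      ∃ (μ' : ℝ) (β' : Fin p → ℝ),
        (∀ i, epiPred μ' β' h (M i) = epiPred μ β h (fun j => M i j - P j)) := by
    intro μ β h
    obtain ⟨μ', β', H⟩ := epiPred_translate (fun j => - P j) μ β h
    exact ⟨μ', β', fun i => by simp [H, sub_eq_add_neg]⟩
  refine ⟨?_, ?_, ?_⟩
  · intro μ β h
    obtain ⟨μ', β', H⟩ := fwd μ β h
    exact ⟨μ', β', H, epiObj_congr _ _ _ _ _ _ _ _ _ H⟩
  · intro μh βh hh hmin
    obtain ⟨μ', β', H⟩ := fwd μh βh hh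
    refine ⟨μ', β', fun μ β h => ?_, H⟩
    obtain ⟨μ₂, β₂, H₂⟩ := bwd μ β h
    rw [epiObj_congr y M (fun i j => M i j - P j) lam _ _ _ _ _ H,
      ← epiObj_congr y (fun i j => M i j - P j) M lam _ _ _ _ _ H₂]
    exact hmin _ _ _
  · intro μt βt ht hmin
    obtain ⟨μ', β', H⟩ := bwd μt βt ht
    refine ⟨μ', β', fun μ β h => ?_, H⟩
    obtain ⟨μ₂, β₂, H₂⟩ := fwd μ β h
    rw [epiObj_congr y (fun i j => M i j - P j) M lam _ _ _ _ _ H,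
      ← epiObj_congr y M (fun i j => M i j - P j) lam _ _ _ _ _ H₂]
    exact hmin _ _ _
end

section
/- There exist n, p ∈ ℕ, data y ∈ ℝ^n, a matrix M ∈ ℝ^{n×p} with rows M_i, a vector P ∈ ℝ^p, and λ > 0 such that, writing M̃ for the translated matrix with rows M̃_i := M_i − P and defining the pure ridge objective with penalized intercept R_M(μ, β) := ∑_{i=1}^n (y_i − μ − ⟨M_i, β⟩)² + λ(μ² + ∑_{j=1}^p β_j²), the unique minimizer of R_M and the unique minimizer of R_{M̃} produce different fitted-value vectors, i.e., there is an index i with μ̂ + ⟨M_i, β̂⟩ ≠ μ̃ + ⟨M̃_i, β̃⟩. -/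
open Finset

/-- Pure ridge objective with penalized intercept ("random intercept"):
`∑ᵢ (yᵢ − μ − ⟨Mᵢ, β⟩)² + λ(μ² + ∑ⱼ βⱼ²)`. -/
noncomputable def pureRidgeObj {p n : ℕ} (y : Fin n → ℝ) (M : Fin n → Fin p → ℝ)
    (lam : ℝ) (μ : ℝ) (β : Fin p → ℝ) : ℝ :=
  ∑ i, (y i - μ - ∑ j, M i j * β j) ^ 2 + lam * (μ ^ 2 + ∑ j, β j ^ 2)

theorem pos_of_ne_pair (a b : ℝ) (β c : Fin 1 → ℝ) (hc : c 0 = b) (μ : ℝ)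
    (h : (μ, β) ≠ (a, c)) : 0 < (μ - a) ^ 2 + (β 0 - b) ^ 2 := by
  by_contra hn
  have h1 : (μ - a) ^ 2 = 0 := by nlinarith [sq_nonneg (μ - a), sq_nonneg (β 0 - b)]
  have h2 : (β 0 - b) ^ 2 = 0 := by nlinarith [sq_nonneg (μ - a), sq_nonneg (β 0 - b)]
  have h3 : μ = a := by linarith [pow_eq_zero_iff (two_ne_zero) |>.mp h1]
  have h4 : β 0 = b := by linarith [pow_eq_zero_iff (two_ne_zero) |>.mp h2]
  apply h
  rw [h3, Prod.mk.injEq]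
  refine ⟨rfl, ?_⟩
  funext i
  rw [Subsingleton.elim i 0, h4, hc]

/-- **Example 2 (a)**: pure ridge regression of the additive model with a penalty on the
size of the intercept is not invariant to translations of the marker coding: there are
data, a coding, a translation and a penalty such that the unique minimizers for the two
codings produce different fitted values. -/
theorem pure_ridge_not_invariant :
    ∃ (n p : ℕ) (y : Fin n → ℝ) (M : Fin n → Fin p → ℝ) (P : Fin p → ℝ) (lam : ℝ),
      0 < lam ∧
      ∃ (μh : ℝ) (βh : Fin p → ℝ) (μt : ℝ) (βt : Fin p → ℝ),
        (∀ (μ : ℝ) (β : Fin p → ℝ), (μ, β) ≠ (μh, βh) →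
          pureRidgeObj y M lam μh βh < pureRidgeObj y M lam μ β) ∧
        (∀ (μ : ℝ) (β : Fin p → ℝ), (μ, β) ≠ (μt, βt) →
          pureRidgeObj y (fun i j => M i j - P j) lam μt βt <
            pureRidgeObj y (fun i j => M i j - P j) lam μ β) ∧
        ∃ i : Fin n, μh + ∑ j, M i j * βh j ≠ μt + ∑ j, (M i j - P j) * βt j := by
  refine ⟨1, 1, fun _ => 1, fun _ _ => 1, fun _ => 1, 1, one_pos,
    1 / 3, fun _ => 1 / 3, 1 / 2, fun _ => 0, ?_, ?_, 0, ?_⟩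
  · intro μ β h
    have := pos_of_ne_pair (1 / 3) (1 / 3) β _ rfl μ h
    simp only [pureRidgeObj, Fin.sum_univ_one]
    nlinarith [sq_nonneg ((μ - 1 / 3) + (β 0 - 1 / 3))]
  · intro μ β h
    have := pos_of_ne_pair (1 / 2) 0 β _ rfl μ h
    simp only [pureRidgeObj, Fin.sum_univ_one]
    nlinarith [sq_nonneg (μ - 1 / 2)]
  · simp only [Fin.sum_univ_one]
    norm_num
end

section
/- There exist n, p ∈ ℕ, data y ∈ ℝ^n, a matrix M ∈ ℝ^{n×p} with rows M_i, a vector P ∈ ℝ^p, and penalty factors λ₁, λ₂ > 0 such that, writing M̃ for the translated matrix with rows M̃_i := M_i − P and defining the eRRBLUP objective Q_M(μ, β, h) := ∑_{i=1}^n (y_i − μ − ⟨M_i, β⟩ − ∑_{k<j} h_{j,k} M_{i,j} M_{i,k})² + λ₁ ∑_{j=1}^p β_j² + λ₂ ∑_{k<j} h_{j,k}², minimizers (μ̂, β̂, ĥ) of Q_M and (μ̃, β̃, h̃) of Q_{M̃} exist whose fitted-value vectors differ, i.e., there is an index i with μ̂ + ⟨M_i, β̂⟩ + ∑_{k<j}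 ĥ_{j,k} M_{i,j} M_{i,k} ≠ μ̃ + ⟨M̃_i, β̃⟩ + ∑_{k<j} h̃_{j,k} M̃_{i,j} M̃_{i,k}. -/
open Finset

/-- The eRRBLUP objective for the first order epistasis model (Eq. (7) of the paper):
residual sum of squares with unpenalized intercept `μ`, additive effects `β` penalized
by `λ₁` and interaction effects `h` penalized by `λ₂`. -/
noncomputable def errblupObj {p n : ℕ} (y : Fin n → ℝ) (M : Fin n → Fin p → ℝ)
    (l1 l2 : ℝ) (μ : ℝ) (β : Fin p → ℝ) (h : Fin p → Fin p → ℝ) : ℝ :=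
  ∑ i, (y i - μ - ∑ j, M i j * β j
      - ∑ j, ∑ k ∈ Finset.Iio j, h j k * M i j * M i k) ^ 2
    + l1 * ∑ j, β j ^ 2 + l2 * ∑ j, ∑ k ∈ Finset.Iio j, h j k ^ 2

/-- **The paper's central negative claim (Example 1, eRRBLUP-1)**: eRRBLUP, which
penalizes both additive and interaction effects, is not invariant to translations of the
marker coding: there are data, a coding, a translation and penalty factors such that
minimizers for the two codings exist whose fitted values differ. -/
theorem errblup_not_invariant :
    ∃ (n p : ℕ) (y : Fin n → ℝ) (M : Fin n → Fin p → ℝ) (P : Fin p → ℝ) (l1 l2 : ℝ),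
      0 < l1 ∧ 0 < l2 ∧
      ∃ (μh : ℝ) (βh : Fin p → ℝ) (hh : Fin p → Fin p → ℝ)
        (μt : ℝ) (βt : Fin p → ℝ) (ht : Fin p → Fin p → ℝ),
        (∀ (μ : ℝ) (β : Fin p → ℝ) (h : Fin p → Fin p → ℝ),
          errblupObj y M l1 l2 μh βh hh ≤ errblupObj y M l1 l2 μ β h) ∧
        (∀ (μ : ℝ) (β : Fin p → ℝ) (h : Fin p → Fin p → ℝ),
          errblupObj y (fun i j => M i j - P j) l1 l2 μt βt ht ≤
            errblupObj y (fun i j => M i j - P j) l1 l2 μ β h) ∧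
        ∃ i : Fin n,
          μh + (∑ j, M i j * βh j)
              + ∑ j, ∑ k ∈ Finset.Iio j, hh j k * M i j * M i k ≠
            μt + (∑ j, (M i j - P j) * βt j)
              + ∑ j, ∑ k ∈ Finset.Iio j, ht j k * (M i j - P j) * (M i k - P k) := by
  have e0 : Finset.Iio (0 : Fin 2) = ∅ := by decide
  have e1 : Finset.Iio (1 : Fin 2) = {0} := by decide
  refine ⟨2, 2, ![0, 12], ![![0, 0], ![1, 0]], ![0, -1], 1, 1, one_pos, one_pos,
    4, ![4, 0], fun _ _ => 0, 3, ![3, 0], fun _ _ => 3, ?_, ?_, 0, ?_⟩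
  · intro μ β h
    simp [errblupObj, Fin.sum_univ_two, e0, e1]
    nlinarith [sq_nonneg (μ - 4), sq_nonneg (μ + β 0 - 8), sq_nonneg (β 0 - 4),
      sq_nonneg (β 1), sq_nonneg (h 1 0)]
  · intro μ β h
    simp [errblupObj, Fin.sum_univ_two, e0, e1]
    nlinarith [sq_nonneg (μ + β 1 - 3), sq_nonneg (μ + β 0 + β 1 + h 1 0 - 9),
      sq_nonneg (β 0 - 3), sq_nonneg (β 1), sq_nonneg (h 1 0 - 3)]
  · simp [Fin.sum_univ_two, e0, e1]
end

section
/- There exist data y ∈ ℝ^n, a matrix M ∈ ℝ^{n×2} with rows M_i = (M_{i,1}, M_{i,2}), and a vector P ∈ ℝ² such that, writing M̃ for the translated matrix with rows M̃_i := M_i − P and defining the incomplete-model sum of squared residuals S_M(μ, β₁, h) := ∑_{i=1}^n (y_i − μ − β₁ M_{i,1} − h M_{i,1} M_{i,2})², both S_M and S_{M̃} have unique minimizers (μ̂, β̂₁, ĥ) and (μ̃, β̃₁, h̃), and the corresponding fitted values differ: there is an index i with μ̂ + β̂₁ M_{i,1} + ĥ M_{i,1} M_{i,2} ≠ μ̃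 + β̃₁ M̃_{i,1} + h̃ M̃_{i,1} M̃_{i,2}; in particular, also ĥ ≠ h̃. -/
open Finset

/-- Sum of squared residuals of the incomplete model
`yᵢ ≈ μ + β₁ Mᵢ₁ + h Mᵢ₁ Mᵢ₂`, which includes the interaction `Mᵢ₁Mᵢ₂` but omits the
additive effect of the second marker (not complete in the sense of Definition 1). -/
noncomputable def incompleteSSR {n : ℕ} (y : Fin n → ℝ) (M : Fin n → Fin 2 → ℝ)
    (μ β₁ h : ℝ) : ℝ :=
  ∑ i, (y i - μ - β₁ * M i 0 - h * M i 0 * M i 1) ^ 2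

/-- **Example on incomplete models**: even OLS is not invariant to translations of the
marker coding when the polynomial model is not complete: there are data, a coding and a
translation such that both SSRs have unique minimizers, but the fitted values differ and
in particular the estimated interaction coefficients differ. -/
theorem ols_incomplete_model_not_invariant :
    ∃ (n : ℕ) (y : Fin n → ℝ) (M : Fin n → Fin 2 → ℝ) (P : Fin 2 → ℝ)
      (μh β₁h hh μt β₁t ht : ℝ),
      (∀ μ β₁ h : ℝ, (μ, β₁, h) ≠ (μh, β₁h, hh) →
        incompleteSSR y M μh β₁h hh < incompleteSSR y M μ β₁ h) ∧
      (∀ μ β₁ h : ℝ, (μ, β₁, h) ≠ (μt, β₁t, ht) →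
        incompleteSSR y (fun i j => M i j - P j) μt β₁t ht <
          incompleteSSR y (fun i j => M i j - P j) μ β₁ h) ∧
      (∃ i : Fin n,
        μh + β₁h * M i 0 + hh * M i 0 * M i 1 ≠
          μt + β₁t * (M i 0 - P 0) + ht * (M i 0 - P 0) * (M i 1 - P 1)) ∧
      hh ≠ ht := by
  refine ⟨4, ![0, 0, 0, 2], ![![0, 0], ![1, 0], ![0, 1], ![1, 1]], ![1, 0],
    0, 0, 2, 1, 1, 0, ?_, ?_, ⟨3, ?_⟩, ?_⟩
  · intro μ β h hne
    by_contra hle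
    apply hne
    simp [incompleteSSR, Fin.sum_univ_four] at hle
    have h1 : μ = 0 := by
      nlinarith [sq_nonneg μ, sq_nonneg (-μ - β), sq_nonneg (2 - μ - β - h)]
    subst h1
    have h2 : β = 0 := by
      nlinarith [sq_nonneg β, sq_nonneg (2 - β - h)]
    subst h2
    have h3 : h = 2 := by
      nlinarith [sq_nonneg (2 - h)]
    subst h3
    rfl
  · intro μ β h hne
    by_contra hle
    apply hne
    simp [incompleteSSR, Fin.sum_univ_four] at hle
    have h1 : μ = 1 := by
      nlinarith [sq_nonneg (μ - 1), sq_nonneg (-μ + β), sq_nonneg (-μ + β + h)]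
    subst h1
    have h2 : β = 1 := by
      nlinarith [sq_nonneg (β - 1), sq_nonneg (-1 + β + h)]
    subst h2
    have h3 : h = 0 := by
      nlinarith [sq_nonneg h]
    subst h3
    rfl
  · simp
  · norm_num
end
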